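/- Fix an integer n ≥ 2 and a real c₁ > 0 with 1 ≤ c₁·ln n ≤ n, and set Δ = c₁·ln n / n and t = Δ/4. Let N ~ Poisson(n·p) where p ∈ [Δ, 1]. Then the bias of U_H evaluated at the empirical frequency N/n satisfies | E[U_H(N/n)] + p·ln p | ≤ 3/(c₁·n·ln n) + 2/( 3·n·(c₁·ln n)² ) + 8024·( p·ln(1/p) + 2p )·n^{−c₁/8}. -/

import Mathlib

open scoped BigOperators

/-- The interpolation polynomial `g(y; a)` of Lemma 1. -/
noncomputable def gfun (a y : ℝ) : ℝ :=
  126 * (y / a) ^ 5 - 420 * (y / a) ^ 6 + 540 * (y / a) ^ 7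
    - 315 * (y / a) ^ 8 + 70 * (y / a) ^ 9

/-- The interpolation function `I_n` with threshold `t`. -/
noncomputable def interp (t x : ℝ) : ℝ :=
  if x ≤ t then 0 else if x < 2 * t then gfun t (x - t) else 1

/-- The "smooth regime" entropy estimator `U_H` (convention `0 · ln 0 = 0` is
automatic since `Real.log 0 = 0`). -/
noncomputable def UH (n : ℕ) (t x : ℝ) : ℝ :=
  interp t x * (-(x * Real.log x) + 1 / (2 * (n : ℝ)))

/-- A function on `(0, ∞)` that decreases before `1` and increases after `1` is minimal at `1`. -/
lemma le_of_hasDerivAt_sign {f f' : ℝ → ℝ} (hf : ∀ x, 0 < x → HasDerivAt f (f' x) x)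
    (hs : ∀ x, 0 < x → 0 ≤ f' x * (x - 1)) {u : ℝ} (hu : 0 < u) : f 1 ≤ f u := by
  rcases lt_trichotomy u 1 with h | h | h
  · obtain ⟨c, hc, he⟩ := exists_hasDerivAt_eq_slope f f' h
      (fun x hx => (hf x (hu.trans_le hx.1)).continuousAt.continuousWithinAt)
      (fun x hx => hf x (hu.trans hx.1))
    have h0 := hs c (hu.trans hc.1)
    have hc' : f' c ≤ 0 := by nlinarith [hc.2]
    rw [eq_div_iff (by linarith)] at he
    nlinarith
  · rw [h]
  · obtain ⟨c, hc, he⟩ := exists_hasDerivAt_eq_slope f f' h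
      (fun x hx => (hf x (one_pos.trans_le hx.1)).continuousAt.continuousWithinAt)
      (fun x hx => hf x (one_pos.trans hx.1))
    have h0 := hs c (one_pos.trans hc.1)
    have hc' : 0 ≤ f' c := by nlinarith [hc.1]
    rw [eq_div_iff (by linarith)] at he
    nlinarith

/-- Fourth-order Taylor-type upper bound for `u log u` at `1`. -/
lemma mul_log_le_taylor {u : ℝ} (hu : 0 ≤ u) :
    u * Real.log u ≤ (u - 1) + (u - 1) ^ 2 / 2 - (u - 1) ^ 3 / 6 + (u - 1) ^ 4 / 3 := by
  rcases hu.eq_or_lt with rfl | hu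
  · norm_num
  have key := le_of_hasDerivAt_sign
    (f := fun x => (x - 1) - (x - 1) ^ 2 / 2 + (x - 1) ^ 3 / 3 - Real.log x)
    (f' := fun x => 1 - (x - 1) + (x - 1) ^ 2 - x⁻¹)
    (fun x hx => by
      have h := (hasDerivAt_id x).sub_const 1
      refine (((h.sub ((h.pow 2).div_const 2)).add ((h.pow 3).div_const 3)).sub
        (Real.hasDerivAt_log hx.ne')).congr_deriv ?_
      simp)
    (fun x hx => by
      have : (1 - (x - 1) + (x - 1) ^ 2 - x⁻¹) * (x - 1) = (x - 1) ^ 4 / x := by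
        field_simp; ring
      rw [this]; positivity) hu
  norm_num at key
  nlinarith [mul_le_mul_of_nonneg_left key hu.le]

/-- Third-order Taylor lower bound for `u log u` at `1`. -/
lemma taylor_le_mul_log {u : ℝ} (hu : 0 ≤ u) :
    (u - 1) + (u - 1) ^ 2 / 2 - (u - 1) ^ 3 / 6 ≤ u * Real.log u := by
  rcases hu.eq_or_lt with rfl | hu
  · norm_num
  have key := le_of_hasDerivAt_sign
    (f := fun x => Real.log x - ((x - 1) + (x - 1) ^ 2 / 2 - (x - 1) ^ 3 / 6) / x)
    (f' := fun x => (x - 1) ^ 3 / (3 * x ^ 2))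
    (fun x hx => by
      have h := (hasDerivAt_id x).sub_const 1
      refine ((Real.hasDerivAt_log hx.ne').sub
        (((h.add ((h.pow 2).div_const 2)).sub ((h.pow 3).div_const 6)).div
          (hasDerivAt_id x) hx.ne')).congr_deriv ?_
      simp; field_simp; ring)
    (fun x hx => by
      have : (x - 1) ^ 3 / (3 * x ^ 2) * (x - 1) = (x - 1) ^ 4 / (3 * x ^ 2) := by ring
      rw [this]; positivity) hu
  norm_num at key
  rwa [div_le_iff₀ hu, mul_comm] at key

lemma interp_mem_Icc {t : ℝ} (ht : 0 < t) (x : ℝ) : interp t x ∈ Set.Icc (0 : ℝ) 1 := by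
  unfold interp gfun
  split_ifs with h1 h2
  · simp
  · obtain ⟨z, hz⟩ : ∃ z, z = (x - t) / t := ⟨_, rfl⟩
    have hz0 : 0 ≤ z := by rw [hz]; exact div_nonneg (by linarith) ht.le
    have hz1 : 0 ≤ 1 - z := by
      rw [hz, sub_nonneg, div_le_one ht]; linarith
    rw [← hz]
    constructor
    · have : 0 ≤ z ^ 5 * (1 + 5 * (1 - z) + 15 * (1 - z) ^ 2 + 35 * (1 - z) ^ 3
          + 70 * (1 - z) ^ 4) := by positivity
      linear_combination this
    · have : 0 ≤ (1 - z) ^ 5 * (1 + 5 * z + 15 * z ^ 2 + 35 * z ^ 3 + 70 * z ^ 4) := by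
        positivity
      linear_combination this
  · simp

/-- The probability that a Poisson variable of mean `l` equals `j`. -/
noncomputable def poissonWeight (l : ℝ) (j : ℕ) : ℝ :=
  Real.exp (-l) * l ^ j / (Nat.factorial j : ℝ)

lemma poissonWeight_nonneg {l : ℝ} (hl : 0 ≤ l) (j : ℕ) : 0 ≤ poissonWeight l j := by
  unfold poissonWeight; positivity

/-- Probability generating function of the Poisson distribution. -/
lemma hasSum_poissonWeight_mul_pow (l z : ℝ) :
    HasSum (fun j : ℕ => poissonWeight l j * z ^ j) (Real.exp (l * z - l)) := by
  have h := (NormedSpace.expSeries_div_hasSum_exp (l * z)).mul_left (Real.exp (-l))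
  rw [← Real.exp_eq_exp_ℝ, ← Real.exp_add, neg_add_eq_sub] at h
  refine h.congr_fun ?_
  intro j
  simp only [poissonWeight, mul_pow]; ring

/-- The identity `E[N f(N - 1)] = l E[f(N)]` for `N` Poisson of mean `l`. -/
lemma hasSum_poissonWeight_shift {l : ℝ} {f : ℝ → ℝ} {s : ℝ}
    (h : HasSum (fun j : ℕ => poissonWeight l j * f j) s) :
    HasSum (fun j : ℕ => poissonWeight l j * (j * f (j - 1))) (l * s) := by
  rw [← hasSum_nat_add_iff' 1]
  simp only [Finset.range_one, Finset.sum_singleton, Nat.cast_zero, zero_mul, mul_zero, sub_zero]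
  refine (h.mul_left l).congr_fun fun j => ?_
  unfold poissonWeight
  rw [Nat.factorial_succ]
  push_cast
  rw [add_sub_cancel_right, pow_succ]
  field_simp

/-- Moments of a polynomial of degree four in a normalised Poisson variable `N / l`, expanded
around `1`. -/
lemma hasSum_poissonWeight_quartic {l : ℝ} (hl : 0 < l) (a b c d e : ℝ) :
    HasSum (fun j : ℕ => poissonWeight l j * (a + b * (j / l - 1) + c * (j / l - 1) ^ 2
        + d * (j / l - 1) ^ 3 + e * (j / l - 1) ^ 4))
      (a + c / l + d / l ^ 2 + e * (3 * l + 1) / l ^ 3) := by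
  have m0 : HasSum (fun j : ℕ => poissonWeight l j * 1) 1 := by
    simpa using hasSum_poissonWeight_mul_pow l 1
  have m1 : HasSum (fun j : ℕ => poissonWeight l j * (j * 1)) (l * 1) :=
    hasSum_poissonWeight_shift (f := fun _ => 1) m0
  have m2 : HasSum (fun j : ℕ => poissonWeight l j * (j * ((j - 1) * 1))) (l * (l * 1)) :=
    hasSum_poissonWeight_shift (f := fun x => x * 1) m1
  have m3 : HasSum (fun j : ℕ => poissonWeight l j * (j * ((j - 1) * ((j - 1 - 1) * 1))))
      (l * (l * (l * 1))) :=
    hasSum_poissonWeight_shift (f := fun x => x * ((x - 1) * 1)) m2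
  have m4 : HasSum (fun j : ℕ => poissonWeight l j *
      (j * ((j - 1) * ((j - 1 - 1) * ((j - 1 - 1 - 1) * 1))))) (l * (l * (l * (l * 1)))) :=
    hasSum_poissonWeight_shift (f := fun x => x * ((x - 1) * ((x - 1 - 1) * 1))) m3
  have h := ((((m0.mul_left (a - b + c - d + e)).add
    (m1.mul_left (b / l + c * (1 / l ^ 2 - 2 / l) + d * (1 / l ^ 3 - 3 / l ^ 2 + 3 / l)
      + e * (1 / l ^ 4 - 4 / l ^ 3 + 6 / l ^ 2 - 4 / l)))).add
    (m2.mul_left (c / l ^ 2 + d * (3 / l ^ 3 - 3 / l ^ 2)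
      + e * (7 / l ^ 4 - 12 / l ^ 3 + 6 / l ^ 2)))).add
    (m3.mul_left (d / l ^ 3 + e * (6 / l ^ 4 - 4 / l ^ 3)))).add
    (m4.mul_left (e / l ^ 4))
  have hs : a + c / l + d / l ^ 2 + e * (3 * l + 1) / l ^ 3 = (a - b + c - d + e) * 1
      + (b / l + c * (1 / l ^ 2 - 2 / l) + d * (1 / l ^ 3 - 3 / l ^ 2 + 3 / l)
        + e * (1 / l ^ 4 - 4 / l ^ 3 + 6 / l ^ 2 - 4 / l)) * (l * 1)
      + (c / l ^ 2 + d * (3 / l ^ 3 - 3 / l ^ 2)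
        + e * (7 / l ^ 4 - 12 / l ^ 3 + 6 / l ^ 2)) * (l * (l * 1))
      + (d / l ^ 3 + e * (6 / l ^ 4 - 4 / l ^ 3)) * (l * (l * (l * 1)))
      + e / l ^ 4 * (l * (l * (l * (l * 1)))) := by
    field_simp
    ring
  rw [hs]
  exact h.congr_fun fun j => by ring

/-- The truncation in `UH` changes the plug-in value by an amount that is exponentially small
in `n * p / 2 - j`. -/
lemma abs_UH_sub_le {n j : ℕ} {L p : ℝ} (hn : 0 < (n : ℝ)) (hL : 1 ≤ L) (hp1 : L / n ≤ p)
    (hp2 : p ≤ 1) :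
    |UH n (L / n / 4) (j / n) - (-((j / n : ℝ) * Real.log (j / n)) + 1 / (2 * (n : ℝ)))|
      ≤ (p * Real.log (1 / p) + 2 * p) * Real.exp (n * p / 2 * Real.log 2)
        * (1 / 2 : ℝ) ^ j := by
  have hp : 0 < p := lt_of_lt_of_le (by positivity) hp1
  have hlp : Real.log p ≤ 0 := Real.log_nonpos hp.le hp2
  have hB : 0 ≤ p * Real.log (1 / p) + 2 * p := by
    rw [one_div, Real.log_inv]; nlinarith
  have hI := interp_mem_Icc (t := L / n / 4) (by positivity) ((j : ℝ) / n)
  by_cases hx : (j : ℝ) / n < 2 * (L / n / 4)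
  · have hLp : L ≤ n * p := by rw [div_le_iff₀ hn] at hp1; linarith
    have hj : (j : ℝ) ≤ n * p / 2 := by
      have : 2 * (L / n / 4) = (L / 2) / n := by ring
      rw [this, div_lt_div_iff_of_pos_right hn] at hx
      linarith
    have hE : 1 ≤ Real.exp (n * p / 2 * Real.log 2) * (1 / 2 : ℝ) ^ j := by
      have h2 : (1 / 2 : ℝ) ^ j = Real.exp (-(j * Real.log 2)) := by
        rw [Real.exp_neg, mul_comm, Real.exp_mul, Real.exp_log two_pos, Real.rpow_natCast]
        simp
      rw [h2, ← Real.exp_add]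
      apply Real.one_le_exp
      nlinarith [Real.log_pos one_lt_two]
    obtain ⟨x, hxd⟩ : ∃ x : ℝ, x = j / n := ⟨_, rfl⟩
    have hx0 : 0 ≤ x := by rw [hxd]; positivity
    have hxp : x ≤ p := by rw [hxd, div_le_iff₀ hn]; nlinarith
    have hn1 : 1 / (2 * (n : ℝ)) ≤ p := by
      rw [div_le_iff₀ (by positivity)]; nlinarith
    have hn0 : 0 < 1 / (2 * (n : ℝ)) := by positivity
    have hlog : x * Real.log x ≤ 0 :=
      mul_nonpos_of_nonneg_of_nonpos hx0 (Real.log_nonpos hx0 (hxp.trans hp2))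
    have hlow : x * Real.log p - p ≤ x * Real.log x := by
      rcases hx0.eq_or_lt with h0 | h0
      · rw [← h0]; simp [hp.le]
      · have h3 := Real.log_le_sub_one_of_pos (div_pos hp h0)
        rw [Real.log_div hp.ne' h0.ne'] at h3
        have h4 : x * (p / x - 1) = p - x := by field_simp
        nlinarith [mul_le_mul_of_nonneg_left h3 h0.le]
    have hF : |-(x * Real.log x) + 1 / (2 * (n : ℝ))| ≤ p * Real.log (1 / p) + 2 * p := by
      rw [abs_of_nonneg (by linarith), one_div p, Real.log_inv]
      nlinarith
    have hI1 : |interp (L / n / 4) x - 1| ≤ 1 := by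
      rw [← hxd] at hI
      rw [abs_le]; constructor <;> linarith [hI.1, hI.2]
    rw [← hxd, UH]
    calc _ = |interp (L / n / 4) x - 1| * |-(x * Real.log x) + 1 / (2 * (n : ℝ))| := by
          rw [← abs_mul]; congr 1; ring
      _ ≤ 1 * (p * Real.log (1 / p) + 2 * p) := by gcongr
      _ ≤ _ := by rw [mul_assoc]; nlinarith
  · have hI1 : interp (L / n / 4) (j / n) = 1 := by
      have : ¬ (j : ℝ) / n ≤ L / n / 4 := by
        have : 0 < L / n / 4 := by positivity
        linarith
      rw [interp, if_neg this, if_neg hx]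
    rw [UH, hI1, one_mul, sub_self, abs_zero]
    positivity

/-- The plug-in entropy value at `j / n`, rescaled by the mean `n * p`. -/
lemma div_mul_log_div {n j : ℕ} {p : ℝ} (hn : 0 < (n : ℝ)) (hp : 0 < p) :
    (j / n : ℝ) * Real.log (j / n) = p * Real.log p * (j / (n * p))
      + p * ((j / (n * p)) * Real.log (j / (n * p))) := by
  rcases Nat.eq_zero_or_pos j with rfl | hj
  · simp
  have hj' : (0 : ℝ) < j := by exact_mod_cast hj
  have : (j : ℝ) / n = p * (j / (n * p)) := by field_simp
  rw [this, Real.log_mul hp.ne' (by positivity)]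
  ring

/-- The Chernoff factor for the lower tail at half the mean. -/
lemma exp_chernoff_le {n : ℕ} {c p : ℝ} (hn : 0 < (n : ℝ)) (hp : 0 < p)
    (h : c * Real.log n ≤ n * p) :
    Real.exp (n * p / 2 * Real.log 2) * Real.exp (n * p * (1 / 2) - n * p)
      ≤ (n : ℝ) ^ (-(c / 8)) := by
  rw [← Real.exp_add, Real.rpow_def_of_pos hn, Real.exp_le_exp]
  nlinarith [Real.log_two_lt_d9, mul_pos hn hp]

theorem UH_bias_bound (n : ℕ) (hn : 2 ≤ n) (c₁ : ℝ) (hc₁ : 0 < c₁)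
    (h1 : 1 ≤ c₁ * Real.log n) (h2 : c₁ * Real.log n ≤ (n : ℝ))
    (p : ℝ) (hp1 : c₁ * Real.log n / n ≤ p) (hp2 : p ≤ 1) :
    |(∑' j : ℕ, Real.exp (-((n : ℝ) * p)) * ((n : ℝ) * p) ^ j / (Nat.factorial j : ℝ) *
          UH n (c₁ * Real.log n / n / 4) ((j : ℝ) / (n : ℝ))) + p * Real.log p|
      ≤ 3 / (c₁ * (n : ℝ) * Real.log n)
        + 2 / (3 * (n : ℝ) * (c₁ * Real.log n) ^ 2)
        + 8024 * (p * Real.log (1 / p) + 2 * p) * (n : ℝ) ^ (-(c₁ / 8)) := by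
  have hn0 : 0 < (n : ℝ) := by positivity
  obtain ⟨L, hL⟩ : ∃ L, L = c₁ * Real.log n := ⟨_, rfl⟩
  have hLp : L ≤ n * p := by rw [hL]; rw [div_le_iff₀ hn0] at hp1; linarith
  have hL1 : 1 ≤ L := hL ▸ h1
  have hp : 0 < p := pos_of_mul_pos_right (by linarith) hn0.le
  obtain ⟨l, hl⟩ : ∃ l, l = n * p := ⟨_, rfl⟩
  have hl0 : 0 < l := by rw [hl]; positivity
  have hpl : p = l / n := by rw [hl]; field_simp
  obtain ⟨B, hB⟩ : ∃ B, B = p * Real.log (1 / p) + 2 * p := ⟨_, rfl⟩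
  have hB0 : 0 ≤ B := by
    rw [hB, one_div, Real.log_inv]; nlinarith [Real.log_nonpos hp.le hp2]
  obtain ⟨E, hE⟩ : ∃ E, E = B * Real.exp (l / 2 * Real.log 2) := ⟨_, rfl⟩
  have htail := hasSum_poissonWeight_mul_pow l (1 / 2)
  have hup := (hasSum_poissonWeight_quartic hl0 (-(p * Real.log p) + 1 / (2 * n))
    (-(p * Real.log p) - p) (-(p / 2)) (p / 6) 0).add (htail.mul_left E)
  have hlow := (hasSum_poissonWeight_quartic hl0 (-(p * Real.log p) + 1 / (2 * n))
    (-(p * Real.log p) - p) (-(p / 2)) (p / 6) (-(p / 3))).sub (htail.mul_left E)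
  have hUH (j : ℕ) := abs_le.1 (abs_UH_sub_le (j := j) hn0 hL1 (hL ▸ hp1) hp2)
  simp only [← hl, ← hB, ← hE, div_mul_log_div hn0 hp] at hUH
  have hleU (j : ℕ) := mul_le_mul_of_nonneg_left
    (a := poissonWeight l j) (b := UH n (L / n / 4) (j / n))
    (c := -(p * Real.log p) + 1 / (2 * n) + (-(p * Real.log p) - p) * (j / l - 1)
      + -(p / 2) * (j / l - 1) ^ 2 + p / 6 * (j / l - 1) ^ 3 + 0 * (j / l - 1) ^ 4
      + E * (1 / 2) ^ j)
    (by
      have h := mul_le_mul_of_nonneg_left (taylor_le_mul_log (u := j / l) (by positivity)) hp.le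
      linarith [(hUH j).2]) (poissonWeight_nonneg hl0.le j)
  have hleL (j : ℕ) := mul_le_mul_of_nonneg_left
    (a := poissonWeight l j) (c := UH n (L / n / 4) (j / n))
    (b := -(p * Real.log p) + 1 / (2 * n) + (-(p * Real.log p) - p) * (j / l - 1)
      + -(p / 2) * (j / l - 1) ^ 2 + p / 6 * (j / l - 1) ^ 3 + -(p / 3) * (j / l - 1) ^ 4
      - E * (1 / 2) ^ j)
    (by
      have h := mul_le_mul_of_nonneg_left (mul_log_le_taylor (u := j / l) (by positivity)) hp.le
      linarith [(hUH j).1]) (poissonWeight_nonneg hl0.le j)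
  have hsum : Summable (fun j : ℕ => poissonWeight l j * UH n (L / n / 4) (j / n)) := by
    have h := Summable.of_nonneg_of_le (fun j => sub_nonneg.2 (hleL j))
      (fun j => sub_le_sub_right (hleU j) _)
      ((hup.summable.sub hlow.summable).congr fun j => by ring)
    exact (h.add hlow.summable).congr fun j => by ring
  have hU := hasSum_le (fun j => (hleU j).trans_eq (by ring)) hsum.hasSum hup
  have hLo := hasSum_le (fun j => (hleL j).trans_eq' (by ring)) hlow hsum.hasSum
  have hsum_eq : (∑' j : ℕ, Real.exp (-((n : ℝ) * p)) * ((n : ℝ) * p) ^ j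
      / (Nat.factorial j : ℝ) * UH n (c₁ * Real.log n / n / 4) ((j : ℝ) / (n : ℝ)))
      = ∑' j : ℕ, poissonWeight l j * UH n (L / n / 4) (j / n) := by
    rw [hL, hl]; rfl
  rw [hsum_eq]
  have hR : E * Real.exp (l * (1 / 2) - l) ≤ 8024 * B * (n : ℝ) ^ (-(c₁ / 8)) := by
    have h := mul_le_mul_of_nonneg_left (exp_chernoff_le hn0 hp (hL ▸ hLp)) hB0
    have h' : 0 ≤ B * (n : ℝ) ^ (-(c₁ / 8)) := by positivity
    rw [← hl] at h
    rw [hE, mul_assoc]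
    linarith
  have hLl : L ≤ l := hl ▸ hLp
  have e1 : 3 / (c₁ * (n : ℝ) * Real.log n) = 3 / (n * L) := by rw [hL]; ring
  have b1 : 1 / (n * l) ≤ 1 / (n * L) := by gcongr
  have b2 : 1 / (n * l ^ 2) ≤ 1 / (n * L ^ 2) := by gcongr
  have b0 : 0 < 1 / (n * l) := by positivity
  have b3 : 0 < 1 / (n * l ^ 2) := by positivity
  have r1 : 3 / (n * L) = 3 * (1 / (n * L)) := by ring
  have r2 : 2 / (3 * n * L ^ 2) = 2 / 3 * (1 / (n * L ^ 2)) := by field_simp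
  have s1 : 1 / (2 * n) + -(p / 2) / l + p / 6 / l ^ 2 = 1 / 6 * (1 / (n * l)) := by
    rw [hpl]; field_simp; ring
  have s2 : -(p / 3) * (3 * l + 1) / l ^ 3 = -(1 / (n * l)) - 1 / 3 * (1 / (n * l ^ 2)) := by
    rw [hpl]; field_simp; ring
  rw [zero_mul, zero_div] at hU
  rw [s2] at hLo
  rw [e1, ← hL, ← hB, r1, r2, abs_le]
  constructor <;> linarith
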